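/- arXiv:2512.22014 — 9 statements merged into one kernel-verified Lean document; each statement's English description precedes it below -/
import Mathlib

section
/- Let H1 and H2 be two hypergraphs with the same label space L and the same injective hash function g used for the Hypergraph Weisfeiler–Lehman (HWL) test. Let A be a hypergraph neural network that updates hyperedge and node features by h_e^{(k)} = AGG_e(h_e^{(k-1)}, {{h_v^{(k-1)} : v ∈ N_v(e)}}) and h_v^{(k)} = AGG_v(h_v^{(k-1)}, {{h_e^{(k)} : e ∈ N_e(v)}}) for some fixed functions AGG_e and AGG_v of a feature and a finite multiset of features, whose initial features satisfy h_v^{(0)} = l_v^{(0)} and h_e^{(0)} = l_e^{(0)}, and whose output A(H) depends only on the multiset of node features and the multiset of hyperedge features after K iterations (a permutation-invariant readout). If A(H1) ≠ A(H2), then the HWL test decides H1 and H2 non-isomorphic at some iteration k ≤ K, i.e., the multisets of HWL node labels or of HWL hyperedge labels of H1 and H2 differ at some iteration k ≤ K. -/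
/-- A hypergraph: a finite vertex set together with a finite set of hyperedges,
each hyperedge being a nonempty subset of the vertex set. -/
structure FinHypergraph (V : Type) where
  verts : Finset V
  edges : Finset (Finset V)
  edge_subset : ∀ e ∈ edges, e ⊆ verts
  edge_nonempty : ∀ e ∈ edges, e.Nonempty

/-- `N_e(v)`: the hyperedges of `H` that contain the vertex `v`. -/
def FinHypergraph.incEdges {V : Type} [DecidableEq V] (H : FinHypergraph V) (v : V) :
    Finset (Finset V) :=
  H.edges.filter (fun e => v ∈ e)

/-- **Lemma 1 of the paper.**
If a hypergraph neural network (with fixed aggregation functions, initial features equal to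
the initial HWL labels, and a readout depending only on the multisets of node and hyperedge
features after `K` iterations) maps `H₁` and `H₂` to different embeddings, then the HWL test
(run with an injective hash function `g`) decides `H₁` and `H₂` non-isomorphic at some
iteration `k ≤ K`: the multisets of HWL node labels or of HWL hyperedge labels differ. -/
theorem hgnn_distinguishes_implies_hwl_distinguishes
    {V₁ V₂ L Y : Type} [DecidableEq V₁] [DecidableEq V₂] [Countable L]
    (H₁ : FinHypergraph V₁) (H₂ : FinHypergraph V₂)
    (g : L → Multiset L → L)
    (hg : Function.Injective (fun p : L × Multiset L => g p.1 p.2))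
    -- HWL labels of H₁ and H₂, computed with the injective hash function g
    (lv₁ : ℕ → V₁ → L) (le₁ : ℕ → Finset V₁ → L)
    (lv₂ : ℕ → V₂ → L) (le₂ : ℕ → Finset V₂ → L)
    (hle₁ : ∀ k, ∀ e ∈ H₁.edges, le₁ (k + 1) e = g (le₁ k e) (e.val.map (lv₁ k)))
    (hlv₁ : ∀ k, ∀ v ∈ H₁.verts,
      lv₁ (k + 1) v = g (lv₁ k v) ((H₁.incEdges v).val.map (le₁ (k + 1))))
    (hle₂ : ∀ k, ∀ e ∈ H₂.edges, le₂ (k + 1) e = g (le₂ k e) (e.val.map (lv₂ k)))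
    (hlv₂ : ∀ k, ∀ v ∈ H₂.verts,
      lv₂ (k + 1) v = g (lv₂ k v) ((H₂.incEdges v).val.map (le₂ (k + 1))))
    -- the HGNN: fixed aggregation functions shared by both hypergraphs;
    -- features live in L since initial features equal initial labels
    (AGGe AGGv : L → Multiset L → L)
    (hv₁ : ℕ → V₁ → L) (he₁ : ℕ → Finset V₁ → L)
    (hv₂ : ℕ → V₂ → L) (he₂ : ℕ → Finset V₂ → L)
    (hhe₁ : ∀ k, ∀ e ∈ H₁.edges, he₁ (k + 1) e = AGGe (he₁ k e) (e.val.map (hv₁ k)))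
    (hhv₁ : ∀ k, ∀ v ∈ H₁.verts,
      hv₁ (k + 1) v = AGGv (hv₁ k v) ((H₁.incEdges v).val.map (he₁ (k + 1))))
    (hhe₂ : ∀ k, ∀ e ∈ H₂.edges, he₂ (k + 1) e = AGGe (he₂ k e) (e.val.map (hv₂ k)))
    (hhv₂ : ∀ k, ∀ v ∈ H₂.verts,
      hv₂ (k + 1) v = AGGv (hv₂ k v) ((H₂.incEdges v).val.map (he₂ (k + 1))))
    -- initial features equal the initial HWL labels
    (h0v₁ : ∀ v ∈ H₁.verts, hv₁ 0 v = lv₁ 0 v)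
    (h0e₁ : ∀ e ∈ H₁.edges, he₁ 0 e = le₁ 0 e)
    (h0v₂ : ∀ v ∈ H₂.verts, hv₂ 0 v = lv₂ 0 v)
    (h0e₂ : ∀ e ∈ H₂.edges, he₂ 0 e = le₂ 0 e)
    -- permutation-invariant readout after K iterations
    (R : Multiset L → Multiset L → Y) (K : ℕ)
    (hA : R (H₁.verts.val.map (hv₁ K)) (H₁.edges.val.map (he₁ K)) ≠
      R (H₂.verts.val.map (hv₂ K)) (H₂.edges.val.map (he₂ K))) :
    ∃ k ≤ K,
      H₁.verts.val.map (lv₁ k) ≠ H₂.verts.val.map (lv₂ k) ∨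
      H₁.edges.val.map (le₁ k) ≠ H₂.edges.val.map (le₂ k) := by
  have key : ∀ k, ∃ φ ψ : L → L,
      (∀ v ∈ H₁.verts, hv₁ k v = φ (lv₁ k v)) ∧ (∀ v ∈ H₂.verts, hv₂ k v = φ (lv₂ k v)) ∧
      (∀ e ∈ H₁.edges, he₁ k e = ψ (le₁ k e)) ∧ (∀ e ∈ H₂.edges, he₂ k e = ψ (le₂ k e)) := by
    intro k
    induction k with
    | zero => exact ⟨id, id, h0v₁, h0v₂, h0e₁, h0e₂⟩
    | succ k ih =>
      obtain ⟨φ, ψ, a1, a2, b1, b2⟩ := ih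
      have ext : ∀ F : L × Multiset L → L, ∃ χ : L → L, ∀ a m, χ (g a m) = F (a, m) := fun F =>
        ⟨Function.extend (fun p : L × Multiset L => g p.1 p.2) F id,
          fun a m => hg.extend_apply F id (a, m)⟩
      obtain ⟨ψ', hψ⟩ := ext (fun p => AGGe (ψ p.1) (p.2.map φ))
      obtain ⟨φ', hφ⟩ := ext (fun p => AGGv (φ p.1) (p.2.map ψ'))
      have c1 : ∀ e ∈ H₁.edges, he₁ (k + 1) e = ψ' (le₁ (k + 1) e) := by
        intro e he
        rw [hhe₁ k e he, hle₁ k e he, hψ, b1 e he, Multiset.map_map]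
        exact congrArg _ (Multiset.map_congr rfl fun v hv => a1 v (H₁.edge_subset e he hv))
      have c2 : ∀ e ∈ H₂.edges, he₂ (k + 1) e = ψ' (le₂ (k + 1) e) := by
        intro e he
        rw [hhe₂ k e he, hle₂ k e he, hψ, b2 e he, Multiset.map_map]
        exact congrArg _ (Multiset.map_congr rfl fun v hv => a2 v (H₂.edge_subset e he hv))
      refine ⟨φ', ψ', ?_, ?_, c1, c2⟩
      · intro v hv
        rw [hhv₁ k v hv, hlv₁ k v hv, hφ, a1 v hv, Multiset.map_map]
        exact congrArg _ (Multiset.map_congr rfl fun e he => c1 e (Finset.mem_filter.mp he).1)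
      · intro v hv
        rw [hhv₂ k v hv, hlv₂ k v hv, hφ, a2 v hv, Multiset.map_map]
        exact congrArg _ (Multiset.map_congr rfl fun e he => c2 e (Finset.mem_filter.mp he).1)
  obtain ⟨φ, ψ, a1, a2, b1, b2⟩ := key K
  refine ⟨K, le_rfl, ?_⟩
  by_contra hcon
  rw [not_or, not_not, not_not] at hcon
  apply hA
  have e1 := congrArg (Multiset.map φ) hcon.1
  have e2 := congrArg (Multiset.map ψ) hcon.2
  simp only [Multiset.map_map] at e1 e2
  rw [Multiset.map_congr rfl a1, Multiset.map_congr rfl a2, Multiset.map_congr rfl b1,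
    Multiset.map_congr rfl b2]
  exact congrArg₂ R e1 e2
end

section
/- Let H1 and H2 be two hypergraphs carrying HWL labels l_v^{(i)}, l_e^{(i)} produced with an injective hash function g, and let a hypergraph neural network compute features by h_e^{(i)} = AGG_e(h_e^{(i-1)}, {{h_v^{(i-1)} : v ∈ N_v(e)}}) and h_v^{(i)} = AGG_v(h_v^{(i-1)}, {{h_e^{(i)} : e ∈ N_e(v)}}) for fixed functions AGG_e, AGG_v, with initial features h_v^{(0)} = l_v^{(0)} and h_e^{(0)} = l_e^{(0)}. Then for every iteration i there exist functions φ_v^{(i)} : L → X and φ_e^{(i)} : L → X (where X is the feature space) such that h_v^{(i)} = φ_v^{(i)}(l_v^{(i)}) for every vertex v of H1 or H2, and h_e^{(i)} = φ_e^{(i)}(l_e^{(i)}) for every hyperedge e of H1 or H2. In particular, any two vertices (of either hypergraph) with equal HWL labels at iteration i have equal HGNN features at iteration i, and likewise for hyperedges. -/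
/-- A hypergraph: a finite vertex set together with a finite set of hyperedges,
each hyperedge being a nonempty subset of the vertex set. -/
structure HWLHypergraph (V : Type) where
  verts : Finset V
  edges : Finset (Finset V)
  edge_subset : ∀ e ∈ edges, e ⊆ verts
  edge_nonempty : ∀ e ∈ edges, e.Nonempty

/-- `N_e(v)`: the hyperedges of `H` that contain the vertex `v`. -/
def HWLHypergraph.incEdges {V : Type} [DecidableEq V] (H : HWLHypergraph V) (v : V) :
    Finset (Finset V) :=
  H.edges.filter (fun e => v ∈ e)

/-- Features of an HGNN are functions of the HWL labels.
For hypergraphs `H₁, H₂` with HWL labels computed via an injective hash function `g` and an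
HGNN with fixed aggregation functions whose initial features equal the initial HWL labels,
at every iteration `i` there exist maps `φv, φe` from the label space to the feature space
with `h_v^{(i)} = φv (l_v^{(i)})` for every vertex of either hypergraph and
`h_e^{(i)} = φe (l_e^{(i)})` for every hyperedge of either hypergraph.  In particular, any
two vertices (of either hypergraph) with equal HWL labels at iteration `i` have equal HGNN
features at iteration `i`, and likewise for hyperedges. -/
theorem hgnn_features_are_functions_of_hwl_labels
    {V₁ V₂ L : Type} [DecidableEq V₁] [DecidableEq V₂] [Countable L]
    (H₁ : HWLHypergraph V₁) (H₂ : HWLHypergraph V₂)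
    (g : L → Multiset L → L)
    (hg : Function.Injective (fun p : L × Multiset L => g p.1 p.2))
    -- HWL labels of H₁ and H₂, computed with the injective hash function g
    (lv₁ : ℕ → V₁ → L) (le₁ : ℕ → Finset V₁ → L)
    (lv₂ : ℕ → V₂ → L) (le₂ : ℕ → Finset V₂ → L)
    (hle₁ : ∀ k, ∀ e ∈ H₁.edges, le₁ (k + 1) e = g (le₁ k e) (e.val.map (lv₁ k)))
    (hlv₁ : ∀ k, ∀ v ∈ H₁.verts,
      lv₁ (k + 1) v = g (lv₁ k v) ((H₁.incEdges v).val.map (le₁ (k + 1))))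
    (hle₂ : ∀ k, ∀ e ∈ H₂.edges, le₂ (k + 1) e = g (le₂ k e) (e.val.map (lv₂ k)))
    (hlv₂ : ∀ k, ∀ v ∈ H₂.verts,
      lv₂ (k + 1) v = g (lv₂ k v) ((H₂.incEdges v).val.map (le₂ (k + 1))))
    -- the HGNN: fixed aggregation functions shared by both hypergraphs;
    -- features live in L since initial features equal initial labels
    (AGGe AGGv : L → Multiset L → L)
    (hv₁ : ℕ → V₁ → L) (he₁ : ℕ → Finset V₁ → L)
    (hv₂ : ℕ → V₂ → L) (he₂ : ℕ → Finset V₂ → L)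
    (hhe₁ : ∀ k, ∀ e ∈ H₁.edges, he₁ (k + 1) e = AGGe (he₁ k e) (e.val.map (hv₁ k)))
    (hhv₁ : ∀ k, ∀ v ∈ H₁.verts,
      hv₁ (k + 1) v = AGGv (hv₁ k v) ((H₁.incEdges v).val.map (he₁ (k + 1))))
    (hhe₂ : ∀ k, ∀ e ∈ H₂.edges, he₂ (k + 1) e = AGGe (he₂ k e) (e.val.map (hv₂ k)))
    (hhv₂ : ∀ k, ∀ v ∈ H₂.verts,
      hv₂ (k + 1) v = AGGv (hv₂ k v) ((H₂.incEdges v).val.map (he₂ (k + 1))))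
    -- initial features equal the initial HWL labels
    (h0v₁ : ∀ v ∈ H₁.verts, hv₁ 0 v = lv₁ 0 v)
    (h0e₁ : ∀ e ∈ H₁.edges, he₁ 0 e = le₁ 0 e)
    (h0v₂ : ∀ v ∈ H₂.verts, hv₂ 0 v = lv₂ 0 v)
    (h0e₂ : ∀ e ∈ H₂.edges, he₂ 0 e = le₂ 0 e)
 :
    ∀ i : ℕ,
      ((∃ φv : L → L,
          (∀ v ∈ H₁.verts, hv₁ i v = φv (lv₁ i v)) ∧
          (∀ v ∈ H₂.verts, hv₂ i v = φv (lv₂ i v))) ∧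
        (∃ φe : L → L,
          (∀ e ∈ H₁.edges, he₁ i e = φe (le₁ i e)) ∧
          (∀ e ∈ H₂.edges, he₂ i e = φe (le₂ i e)))) ∧
      -- in particular: equal HWL labels imply equal HGNN features
      ((∀ v ∈ H₁.verts, ∀ u ∈ H₁.verts, lv₁ i v = lv₁ i u → hv₁ i v = hv₁ i u) ∧
        (∀ v ∈ H₂.verts, ∀ u ∈ H₂.verts, lv₂ i v = lv₂ i u → hv₂ i v = hv₂ i u) ∧
        (∀ v ∈ H₁.verts, ∀ u ∈ H₂.verts, lv₁ i v = lv₂ i u → hv₁ i v = hv₂ i u) ∧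
        (∀ e ∈ H₁.edges, ∀ w ∈ H₁.edges, le₁ i e = le₁ i w → he₁ i e = he₁ i w) ∧
        (∀ e ∈ H₂.edges, ∀ w ∈ H₂.edges, le₂ i e = le₂ i w → he₂ i e = he₂ i w) ∧
        (∀ e ∈ H₁.edges, ∀ w ∈ H₂.edges, le₁ i e = le₂ i w → he₁ i e = he₂ i w)) := by
  have dec : ∀ F : L → Multiset L → L, ∃ D : L → L, ∀ a m, D (g a m) = F a m := by
    intro F
    refine ⟨Function.extend (fun p : L × Multiset L => g p.1 p.2) (fun p => F p.1 p.2) id, ?_⟩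
    intro a m
    exact hg.extend_apply (fun p : L × Multiset L => F p.1 p.2) id (a, m)
  have key : ∀ i : ℕ,
      ((∃ φv : L → L,
          (∀ v ∈ H₁.verts, hv₁ i v = φv (lv₁ i v)) ∧
          (∀ v ∈ H₂.verts, hv₂ i v = φv (lv₂ i v))) ∧
        (∃ φe : L → L,
          (∀ e ∈ H₁.edges, he₁ i e = φe (le₁ i e)) ∧
          (∀ e ∈ H₂.edges, he₂ i e = φe (le₂ i e)))) := by
    intro i
    induction i with
    | zero => exact ⟨⟨id, h0v₁, h0v₂⟩, ⟨id, h0e₁, h0e₂⟩⟩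
    | succ k ih =>
      obtain ⟨⟨φv, a1, a2⟩, ⟨φe, b1, b2⟩⟩ := ih
      obtain ⟨De, hDe⟩ := dec (fun a m => AGGe (φe a) (m.map φv))
      have c1 : ∀ e ∈ H₁.edges, he₁ (k + 1) e = De (le₁ (k + 1) e) := by
        intro e he
        rw [hle₁ k e he, hDe, hhe₁ k e he, b1 e he, Multiset.map_map]
        congr 1
        exact Multiset.map_congr rfl fun v hv => a1 v (H₁.edge_subset e he hv)
      have c2 : ∀ e ∈ H₂.edges, he₂ (k + 1) e = De (le₂ (k + 1) e) := by
        intro e he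
        rw [hle₂ k e he, hDe, hhe₂ k e he, b2 e he, Multiset.map_map]
        congr 1
        exact Multiset.map_congr rfl fun v hv => a2 v (H₂.edge_subset e he hv)
      obtain ⟨Dv, hDv⟩ := dec (fun a m => AGGv (φv a) (m.map De))
      refine ⟨⟨Dv, ?_, ?_⟩, ⟨De, c1, c2⟩⟩
      · intro v hv
        rw [hlv₁ k v hv, hDv, hhv₁ k v hv, a1 v hv, Multiset.map_map]
        congr 1
        exact Multiset.map_congr rfl fun e he => c1 e (Finset.mem_filter.mp he).1
      · intro v hv
        rw [hlv₂ k v hv, hDv, hhv₂ k v hv, a2 v hv, Multiset.map_map]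
        congr 1
        exact Multiset.map_congr rfl fun e he => c2 e (Finset.mem_filter.mp he).1
  intro i
  refine ⟨key i, ?_⟩
  obtain ⟨⟨φv, a1, a2⟩, ⟨φe, b1, b2⟩⟩ := key i
  refine ⟨?_, ?_, ?_, ?_, ?_, ?_⟩
  · intro v hv u hu h
    rw [a1 v hv, a1 u hu, h]
  · intro v hv u hu h
    rw [a2 v hv, a2 u hu, h]
  · intro v hv u hu h
    rw [a1 v hv, a2 u hu, h]
  · intro v hv u hu h
    rw [b1 v hv, b1 u hu, h]
  · intro v hv u hu h
    rw [b2 v hv, b2 u hu, h]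
  · intro v hv u hu h
    rw [b1 v hv, b2 u hu, h]
end

section
/- Let H1 and H2 be two hypergraphs, and let A be a hypergraph neural network with feature space X that updates features by h_e^{(k)} = φ_e(h_e^{(k-1)}, f_v({{h_v^{(k-1)} : v ∈ N_v(e)}})) and h_v^{(k)} = φ_v(h_v^{(k-1)}, f_e({{h_e^{(k)} : e ∈ N_e(v)}})), where the multiset functions f_v and f_e are injective and the pair functions φ_e and φ_v are injective, with initial features equal to the initial HWL labels (h_v^{(0)} = l_v^{(0)}, h_e^{(0)} = l_e^{(0)}), and whose hypergraph-level readout R, applied to the pair (multiset of node features, multiset of hyperedge features), is injective. If the HWL test (run with an injective hash function g from the same initial labels) decides H1 and H2 non-isomorphic at iteration K, then A with K iterations maps H1 and H2 to different embeddings: A(H1) ≠ A(H2). -/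
/-- **Theorem 1 of the paper.**
An HGNN whose node-to-hyperedge and hyperedge-to-node updates are built from injective
multiset functions `fv, fe` and injective pair functions `φe, φv`, whose initial features
equal the initial HWL labels, and whose hypergraph-level readout `R` on the pair
(multiset of node features, multiset of hyperedge features) is injective, maps any two
hypergraphs that the HWL test decides non-isomorphic at iteration `K` to different
embeddings. -/
theorem hgnn_injective_distinguishes_hwl_distinguishable
    {V₁ V₂ L Mv Me Y : Type} [DecidableEq V₁] [DecidableEq V₂] [Countable L]
    (H₁ : FinHypergraph V₁) (H₂ : FinHypergraph V₂)
    (g : L → Multiset L → L)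
    (hg : Function.Injective (fun p : L × Multiset L => g p.1 p.2))
    -- HWL labels of H₁ and H₂, computed with the injective hash function g
    (lv₁ : ℕ → V₁ → L) (le₁ : ℕ → Finset V₁ → L)
    (lv₂ : ℕ → V₂ → L) (le₂ : ℕ → Finset V₂ → L)
    (hle₁ : ∀ k, ∀ e ∈ H₁.edges, le₁ (k + 1) e = g (le₁ k e) (e.val.map (lv₁ k)))
    (hlv₁ : ∀ k, ∀ v ∈ H₁.verts,
      lv₁ (k + 1) v = g (lv₁ k v) ((H₁.incEdges v).val.map (le₁ (k + 1))))
    (hle₂ : ∀ k, ∀ e ∈ H₂.edges, le₂ (k + 1) e = g (le₂ k e) (e.val.map (lv₂ k)))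
    (hlv₂ : ∀ k, ∀ v ∈ H₂.verts,
      lv₂ (k + 1) v = g (lv₂ k v) ((H₂.incEdges v).val.map (le₂ (k + 1))))
    -- the HGNN: injective multiset functions fv, fe and injective pair functions φe, φv;
    -- features live in L since initial features equal initial labels
    (fv : Multiset L → Mv) (fe : Multiset L → Me)
    (φe : L → Mv → L) (φv : L → Me → L)
    (hfv : Function.Injective fv) (hfe : Function.Injective fe)
    (hφe : Function.Injective (fun p : L × Mv => φe p.1 p.2))
    (hφv : Function.Injective (fun p : L × Me => φv p.1 p.2))
    (hv₁ : ℕ → V₁ → L) (he₁ : ℕ → Finset V₁ → L)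
    (hv₂ : ℕ → V₂ → L) (he₂ : ℕ → Finset V₂ → L)
    (hhe₁ : ∀ k, ∀ e ∈ H₁.edges,
      he₁ (k + 1) e = φe (he₁ k e) (fv (e.val.map (hv₁ k))))
    (hhv₁ : ∀ k, ∀ v ∈ H₁.verts,
      hv₁ (k + 1) v = φv (hv₁ k v) (fe ((H₁.incEdges v).val.map (he₁ (k + 1)))))
    (hhe₂ : ∀ k, ∀ e ∈ H₂.edges,
      he₂ (k + 1) e = φe (he₂ k e) (fv (e.val.map (hv₂ k))))
    (hhv₂ : ∀ k, ∀ v ∈ H₂.verts,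
      hv₂ (k + 1) v = φv (hv₂ k v) (fe ((H₂.incEdges v).val.map (he₂ (k + 1)))))
    -- initial features equal the initial HWL labels
    (h0v₁ : ∀ v ∈ H₁.verts, hv₁ 0 v = lv₁ 0 v)
    (h0e₁ : ∀ e ∈ H₁.edges, he₁ 0 e = le₁ 0 e)
    (h0v₂ : ∀ v ∈ H₂.verts, hv₂ 0 v = lv₂ 0 v)
    (h0e₂ : ∀ e ∈ H₂.edges, he₂ 0 e = le₂ 0 e)
    -- injective hypergraph-level readout on (multiset of node features, multiset of hyperedge features)
    (R : Multiset L → Multiset L → Y)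
    (hR : Function.Injective (fun p : Multiset L × Multiset L => R p.1 p.2))
    (K : ℕ)
    -- the HWL test decides H₁ and H₂ non-isomorphic at iteration K
    (hWL : ∃ k ≤ K,
      H₁.verts.val.map (lv₁ k) ≠ H₂.verts.val.map (lv₂ k) ∨
      H₁.edges.val.map (le₁ k) ≠ H₂.edges.val.map (le₂ k)) :
    R (H₁.verts.val.map (hv₁ K)) (H₁.edges.val.map (he₁ K)) ≠
      R (H₂.verts.val.map (hv₂ K)) (H₂.edges.val.map (he₂ K)) := by
  have hFe : Function.Injective (fun p : L × Multiset L => φe p.1 (fv p.2)) := by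
    rintro ⟨a, m⟩ ⟨b, n⟩ h
    have h2 := @hφe (a, fv m) (b, fv n) h
    simp only [Prod.mk.injEq] at h2 ⊢
    exact ⟨h2.1, hfv h2.2⟩
  have hFv : Function.Injective (fun p : L × Multiset L => φv p.1 (fe p.2)) := by
    rintro ⟨a, m⟩ ⟨b, n⟩ h
    have h2 := @hφv (a, fe m) (b, fe n) h
    simp only [Prod.mk.injEq] at h2 ⊢
    exact ⟨h2.1, hfe h2.2⟩
  have extE : ∀ (G : L × Multiset L → L), ∃ ψ : L → L, ∀ a m, ψ (φe a (fv m)) = G (a, m) :=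
    fun G => ⟨Function.extend (fun p : L × Multiset L => φe p.1 (fv p.2)) G id,
      fun a m => hFe.extend_apply G id (a, m)⟩
  have extV : ∀ (G : L × Multiset L → L), ∃ ψ : L → L, ∀ a m, ψ (φv a (fe m)) = G (a, m) :=
    fun G => ⟨Function.extend (fun p : L × Multiset L => φv p.1 (fe p.2)) G id,
      fun a m => hFv.extend_apply G id (a, m)⟩
  -- labels are a common function of the features
  have key : ∀ k, ∃ ψv ψe : L → L,
      (∀ v ∈ H₁.verts, lv₁ k v = ψv (hv₁ k v)) ∧ (∀ v ∈ H₂.verts, lv₂ k v = ψv (hv₂ k v)) ∧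
      (∀ e ∈ H₁.edges, le₁ k e = ψe (he₁ k e)) ∧ (∀ e ∈ H₂.edges, le₂ k e = ψe (he₂ k e)) := by
    intro k
    induction k with
    | zero =>
      exact ⟨id, id, fun v h => (h0v₁ v h).symm, fun v h => (h0v₂ v h).symm,
        fun v h => (h0e₁ v h).symm, fun v h => (h0e₂ v h).symm⟩
    | succ k ih =>
      obtain ⟨ψv, ψe, a1, a2, b1, b2⟩ := ih
      obtain ⟨ψe', he'⟩ := extE (fun p => g (ψe p.1) (p.2.map ψv))
      obtain ⟨ψv', hv'⟩ := extV (fun p => g (ψv p.1) (p.2.map ψe'))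
      have c1 : ∀ e ∈ H₁.edges, le₁ (k+1) e = ψe' (he₁ (k+1) e) := by
        intro e h
        rw [hle₁ k e h, hhe₁ k e h, he', b1 e h, Multiset.map_map]
        congr 1
        exact Multiset.map_congr rfl fun v hv => a1 v (H₁.edge_subset e h hv)
      have c2 : ∀ e ∈ H₂.edges, le₂ (k+1) e = ψe' (he₂ (k+1) e) := by
        intro e h
        rw [hle₂ k e h, hhe₂ k e h, he', b2 e h, Multiset.map_map]
        congr 1
        exact Multiset.map_congr rfl fun v hv => a2 v (H₂.edge_subset e h hv)
      refine ⟨ψv', ψe', ?_, ?_, c1, c2⟩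
      · intro v h
        rw [hlv₁ k v h, hhv₁ k v h, hv', a1 v h, Multiset.map_map]
        congr 1
        exact Multiset.map_congr rfl fun e he => c1 e (Finset.mem_filter.1 he).1
      · intro v h
        rw [hlv₂ k v h, hhv₂ k v h, hv', a2 v h, Multiset.map_map]
        congr 1
        exact Multiset.map_congr rfl fun e he => c2 e (Finset.mem_filter.1 he).1
  intro hEq
  have hEq2 := @hR (_, _) (_, _) hEq
  simp only [Prod.mk.injEq] at hEq2
  obtain ⟨πe, hπe⟩ := extE Prod.fst
  obtain ⟨πv, hπv⟩ := extV Prod.fst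
  obtain ⟨k, hk, hne⟩ := hWL
  have down : H₁.verts.val.map (hv₁ k) = H₂.verts.val.map (hv₂ k) ∧
      H₁.edges.val.map (he₁ k) = H₂.edges.val.map (he₂ k) := by
    refine Nat.decreasingInduction
      (motive := fun j _ => H₁.verts.val.map (hv₁ j) = H₂.verts.val.map (hv₂ j) ∧
        H₁.edges.val.map (he₁ j) = H₂.edges.val.map (he₂ j)) ?_ hEq2 hk
    rintro j _ ⟨p, q⟩
    have p' := congrArg (Multiset.map πv) p
    have q' := congrArg (Multiset.map πe) q
    rw [Multiset.map_map, Multiset.map_map] at p' q'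
    constructor
    · refine (Multiset.map_congr rfl fun v h => ?_).trans
        (p'.trans (Multiset.map_congr rfl fun v h => ?_))
      · simp only [Function.comp]; rw [hhv₁ j v h, hπv]
      · simp only [Function.comp]; rw [hhv₂ j v h, hπv]
    · refine (Multiset.map_congr rfl fun v h => ?_).trans
        (q'.trans (Multiset.map_congr rfl fun v h => ?_))
      · simp only [Function.comp]; rw [hhe₁ j v h, hπe]
      · simp only [Function.comp]; rw [hhe₂ j v h, hπe]
  obtain ⟨ψv, ψe, a1, a2, b1, b2⟩ := key k
  have p' := congrArg (Multiset.map ψv) down.1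
  have q' := congrArg (Multiset.map ψe) down.2
  rw [Multiset.map_map, Multiset.map_map] at p' q'
  rcases hne with hne | hne
  · exact hne ((Multiset.map_congr rfl a1).trans
      (p'.trans (Multiset.map_congr rfl fun v h => (a2 v h).symm)))
  · exact hne ((Multiset.map_congr rfl b1).trans
      (q'.trans (Multiset.map_congr rfl fun v h => (b2 v h).symm)))
end

section
/- Let H1 and H2 be two hypergraphs, and let features be computed by h_e^{(k)} = φ_e(h_e^{(k-1)}, f_v({{h_v^{(k-1)} : v ∈ N_v(e)}})) and h_v^{(k)} = φ_v(h_v^{(k-1)}, f_e({{h_e^{(k)} : e ∈ N_e(v)}})) with f_v, f_e injective multiset functions and φ_e, φ_v injective pair functions, and let HWL labels be computed with an injective hash function g from the same initial data (h_v^{(0)} = l_v^{(0)}, h_e^{(0)} = l_e^{(0)}). Then for every iteration k there exist injective functions φ̃_e^{(k)} : L → X and φ̃_v^{(k)} : L → X such that h_e^{(k)} = φ̃_e^{(k)}(l_e^{(k)}) for every hyperedge e of H1 or H2 and h_v^{(k)} = φ̃_v^{(k)}(l_v^{(k)}) for every vertex v of H1 or H2. -/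
theorem aux_ext {L : Type} {S : Set L} (hS : S.Finite) (f : S ↪ L) :
    ∃ r : L → L, Function.Injective r ∧ ∀ x : S, r x = f x := by
  cases finite_or_infinite L with
  | inl h =>
    obtain ⟨r, hr⟩ := Cardinal.extend_function_finite f ⟨Equiv.refl L⟩
    exact ⟨r, r.injective, hr⟩
  | inr h =>
    have hlt : Cardinal.mk S < Cardinal.mk L :=
      lt_of_lt_of_le (Cardinal.lt_aleph0_iff_set_finite.2 hS) (Cardinal.aleph0_le_mk L)
    obtain ⟨r, hr⟩ := Cardinal.extend_function_of_lt f hlt ⟨Equiv.refl L⟩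
    exact ⟨r, r.injective, hr⟩

theorem aux_step {L M I J : Type} (g : L → Multiset L → L)
    (hg : Function.Injective (fun p : L × Multiset L => g p.1 p.2))
    (f : Multiset L → M) (φ : L → M → L) (hf : Function.Injective f)
    (hφ : Function.Injective (fun p : L × M => φ p.1 p.2))
    (p q : L → L) (hp : Function.Injective p) (hq : Function.Injective q)
    (s : Finset I) (t : Finset J) (a b : I → L) (c d : J → L)
    (h1 : ∀ i ∈ s, ∃ x m, a i = g x m ∧ b i = φ (p x) (f (m.map q)))
    (h2 : ∀ i ∈ t, ∃ x m, c i = g x m ∧ d i = φ (p x) (f (m.map q))) :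
    ∃ r : L → L, Function.Injective r ∧ (∀ i ∈ s, b i = r (a i)) ∧
      (∀ i ∈ t, d i = r (c i)) := by
  let S : Set L := a '' (s : Set I) ∪ c '' (t : Set J)
  have hS : S.Finite := (s.finite_toSet.image a).union (t.finite_toSet.image c)
  have key : ∀ y : S, ∃ x m, (y : L) = g x m := by
    rintro ⟨y, ⟨i, hi, rfl⟩ | ⟨i, hi, rfl⟩⟩
    · obtain ⟨x, m, h, -⟩ := h1 i hi
      exact ⟨x, m, h⟩
    · obtain ⟨x, m, h, -⟩ := h2 i hi
      exact ⟨x, m, h⟩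
  choose X N hXN using key
  have inj : Function.Injective (fun y : S => φ (p (X y)) (f ((N y).map q))) := by
    intro y z hyz
    have h := @hφ (p (X y), f ((N y).map q)) (p (X z), f ((N z).map q)) hyz
    rw [Prod.mk.injEq] at h
    have e1 := hp h.1
    have e2 := Multiset.map_injective hq (hf h.2)
    apply Subtype.ext
    rw [hXN y, hXN z, e1, e2]
  obtain ⟨r, hr, hrS⟩ := aux_ext hS ⟨_, inj⟩
  have fin : ∀ y : S, ∀ x m, (y : L) = g x m → φ (p x) (f (m.map q)) = r y := by
    intro y x m h
    have h' := @hg (x, m) (X y, N y) (h.symm.trans (hXN y))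
    rw [Prod.mk.injEq] at h'
    rw [hrS, h'.1, h'.2]
    rfl
  refine ⟨r, hr, fun i hi => ?_, fun i hi => ?_⟩
  · obtain ⟨x, m, h, h'⟩ := h1 i hi
    rw [h']
    exact fin ⟨a i, Or.inl ⟨i, hi, rfl⟩⟩ x m h
  · obtain ⟨x, m, h, h'⟩ := h2 i hi
    rw [h']
    exact fin ⟨c i, Or.inr ⟨i, hi, rfl⟩⟩ x m h

/-- With injective multiset functions `fv, fe`, injective pair functions `φe, φv`, and
initial features equal to the initial HWL labels (computed with an injective hash `g`),
at every iteration `k` the HGNN features are *injective* functions of the HWL labels: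
there are injective `φe', φv'` from the label space to the feature space with
`h_e^{(k)} = φe' (l_e^{(k)})` for every hyperedge of either hypergraph and
`h_v^{(k)} = φv' (l_v^{(k)})` for every vertex of either hypergraph. -/
theorem hgnn_features_are_injective_functions_of_hwl_labels
    {V₁ V₂ L Mv Me : Type} [DecidableEq V₁] [DecidableEq V₂] [Countable L]
    (H₁ : FinHypergraph V₁) (H₂ : FinHypergraph V₂)
    (g : L → Multiset L → L)
    (hg : Function.Injective (fun p : L × Multiset L => g p.1 p.2))
    -- HWL labels of H₁ and H₂, computed with the injective hash function g
    (lv₁ : ℕ → V₁ → L) (le₁ : ℕ → Finset V₁ → L)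
    (lv₂ : ℕ → V₂ → L) (le₂ : ℕ → Finset V₂ → L)
    (hle₁ : ∀ k, ∀ e ∈ H₁.edges, le₁ (k + 1) e = g (le₁ k e) (e.val.map (lv₁ k)))
    (hlv₁ : ∀ k, ∀ v ∈ H₁.verts,
      lv₁ (k + 1) v = g (lv₁ k v) ((H₁.incEdges v).val.map (le₁ (k + 1))))
    (hle₂ : ∀ k, ∀ e ∈ H₂.edges, le₂ (k + 1) e = g (le₂ k e) (e.val.map (lv₂ k)))
    (hlv₂ : ∀ k, ∀ v ∈ H₂.verts,
      lv₂ (k + 1) v = g (lv₂ k v) ((H₂.incEdges v).val.map (le₂ (k + 1))))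
    -- the HGNN: injective multiset functions fv, fe and injective pair functions φe, φv;
    -- features live in L since initial features equal initial labels
    (fv : Multiset L → Mv) (fe : Multiset L → Me)
    (φe : L → Mv → L) (φv : L → Me → L)
    (hfv : Function.Injective fv) (hfe : Function.Injective fe)
    (hφe : Function.Injective (fun p : L × Mv => φe p.1 p.2))
    (hφv : Function.Injective (fun p : L × Me => φv p.1 p.2))
    (hv₁ : ℕ → V₁ → L) (he₁ : ℕ → Finset V₁ → L)
    (hv₂ : ℕ → V₂ → L) (he₂ : ℕ → Finset V₂ → L)
    (hhe₁ : ∀ k, ∀ e ∈ H₁.edges,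
      he₁ (k + 1) e = φe (he₁ k e) (fv (e.val.map (hv₁ k))))
    (hhv₁ : ∀ k, ∀ v ∈ H₁.verts,
      hv₁ (k + 1) v = φv (hv₁ k v) (fe ((H₁.incEdges v).val.map (he₁ (k + 1)))))
    (hhe₂ : ∀ k, ∀ e ∈ H₂.edges,
      he₂ (k + 1) e = φe (he₂ k e) (fv (e.val.map (hv₂ k))))
    (hhv₂ : ∀ k, ∀ v ∈ H₂.verts,
      hv₂ (k + 1) v = φv (hv₂ k v) (fe ((H₂.incEdges v).val.map (he₂ (k + 1)))))
    -- initial features equal the initial HWL labels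
    (h0v₁ : ∀ v ∈ H₁.verts, hv₁ 0 v = lv₁ 0 v)
    (h0e₁ : ∀ e ∈ H₁.edges, he₁ 0 e = le₁ 0 e)
    (h0v₂ : ∀ v ∈ H₂.verts, hv₂ 0 v = lv₂ 0 v)
    (h0e₂ : ∀ e ∈ H₂.edges, he₂ 0 e = le₂ 0 e)
 :
    ∀ k : ℕ,
      (∃ φe' : L → L, Function.Injective φe' ∧
        (∀ e ∈ H₁.edges, he₁ k e = φe' (le₁ k e)) ∧
        (∀ e ∈ H₂.edges, he₂ k e = φe' (le₂ k e))) ∧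
      (∃ φv' : L → L, Function.Injective φv' ∧
        (∀ v ∈ H₁.verts, hv₁ k v = φv' (lv₁ k v)) ∧
        (∀ v ∈ H₂.verts, hv₂ k v = φv' (lv₂ k v))) := by
  intro k
  induction k with
  | zero =>
    exact ⟨⟨id, Function.injective_id, h0e₁, h0e₂⟩, ⟨id, Function.injective_id, h0v₁, h0v₂⟩⟩
  | succ k ih =>
    obtain ⟨⟨p, hp, p1, p2⟩, ⟨q, hq, q1, q2⟩⟩ := ih
    have E : ∃ φe' : L → L, Function.Injective φe' ∧
        (∀ e ∈ H₁.edges, he₁ (k + 1) e = φe' (le₁ (k + 1) e)) ∧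
        (∀ e ∈ H₂.edges, he₂ (k + 1) e = φe' (le₂ (k + 1) e)) := by
      refine aux_step g hg fv φe hfv hφe p q hp hq _ _ _ _ _ _ ?_ ?_
      · intro e he
        refine ⟨_, _, hle₁ k e he, ?_⟩
        rw [hhe₁ k e he, p1 e he, Multiset.map_map]
        congr 2
        exact Multiset.map_congr rfl fun v hv => q1 v (H₁.edge_subset e he hv)
      · intro e he
        refine ⟨_, _, hle₂ k e he, ?_⟩
        rw [hhe₂ k e he, p2 e he, Multiset.map_map]
        congr 2
        exact Multiset.map_congr rfl fun v hv => q2 v (H₂.edge_subset e he hv)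
    refine ⟨E, ?_⟩
    obtain ⟨r, hr, r1, r2⟩ := E
    refine aux_step g hg fe φv hfe hφv q r hq hr _ _ _ _ _ _ ?_ ?_
    · intro v hv
      refine ⟨_, _, hlv₁ k v hv, ?_⟩
      rw [hhv₁ k v hv, q1 v hv, Multiset.map_map]
      congr 2
      exact Multiset.map_congr rfl fun e he => r1 e (Finset.mem_filter.1 he).1
    · intro v hv
      refine ⟨_, _, hlv₂ k v hv, ?_⟩
      rw [hhv₂ k v hv, q2 v hv, Multiset.map_map]
      congr 2
      exact Multiset.map_congr rfl fun e he => r2 e (Finset.mem_filter.1 he).1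
end

section
/- Let H1 and H2 be two hypergraphs, and let A be a hypergraph neural network whose updates h_e^{(k)} = φ_e(h_e^{(k-1)}, f_v({{h_v^{(k-1)} : v ∈ N_v(e)}})) and h_v^{(k)} = φ_v(h_v^{(k-1)}, f_e({{h_e^{(k)} : e ∈ N_e(v)}})) use injective multiset functions f_v, f_e and injective pair functions φ_e, φ_v, whose initial features equal the initial HWL labels, and whose hypergraph-level readout R on the pair (multiset of node features, multiset of hyperedge features) is injective. Then for every K, A run for K iterations distinguishes H1 from H2 (A(H1) ≠ A(H2)) if and only if the HWL test run with an injective hash function g from the same initial labels decides H1 and H2 non-isomorphic at some iteration k ≤ K. That is, such an HGNN is exactly as powerful as the HWL test. -/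
/-- `(lv, le)` are the labels obtained on `H` with the hashes `ge`, `gv`. -/
structure IsRun {V L : Type} [DecidableEq V] (H : FinHypergraph V)
    (ge gv : L → Multiset L → L) (lv : ℕ → V → L) (le : ℕ → Finset V → L) : Prop where
  edge : ∀ k, ∀ e ∈ H.edges, le (k + 1) e = ge (le k e) (e.val.map (lv k))
  vert : ∀ k, ∀ v ∈ H.verts,
    lv (k + 1) v = gv (lv k v) ((H.incEdges v).val.map (le (k + 1)))

/-- Transport a function on decoded pairs to a function on labels. -/
theorem exists_decode {L : Type} (g : L → Multiset L → L)
    (hg : Function.Injective (fun p : L × Multiset L => g p.1 p.2))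
    (u : L → Multiset L → L) : ∃ F : L → L, ∀ a m, F (g a m) = u a m :=
  ⟨Function.extend (fun p : L × Multiset L => g p.1 p.2) (fun p => u p.1 p.2) id,
    fun a m => hg.extend_apply (fun p => u p.1 p.2) id (a, m)⟩

theorem run_trans {L : Type} (ge gv ge' gv' : L → Multiset L → L)
    (hge : Function.Injective (fun p : L × Multiset L => ge p.1 p.2))
    (hgv : Function.Injective (fun p : L × Multiset L => gv p.1 p.2)) (k : ℕ) :
    ∃ F G : L → L, ∀ (V : Type) [DecidableEq V] (H : FinHypergraph V)
      (lv lv' : ℕ → V → L) (le le' : ℕ → Finset V → L),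
      IsRun H ge gv lv le → IsRun H ge' gv' lv' le' →
      (∀ v ∈ H.verts, lv' 0 v = lv 0 v) → (∀ e ∈ H.edges, le' 0 e = le 0 e) →
      (∀ v ∈ H.verts, lv' k v = G (lv k v)) ∧ (∀ e ∈ H.edges, le' k e = F (le k e)) := by
  induction k with
  | zero => exact ⟨id, id, fun V _ H lv lv' le le' _ _ h1 h2 => ⟨h1, h2⟩⟩
  | succ k ih =>
    obtain ⟨F, G, ih⟩ := ih
    obtain ⟨F', hF⟩ := exists_decode ge hge (fun a m => ge' (F a) (m.map G))
    obtain ⟨G', hG⟩ := exists_decode gv hgv (fun a m => gv' (G a) (m.map F'))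
    refine ⟨F', G', fun V _ H lv lv' le le' r r' h1 h2 => ?_⟩
    obtain ⟨iv, ie⟩ := ih V H lv lv' le le' r r' h1 h2
    have he : ∀ e ∈ H.edges, le' (k + 1) e = F' (le (k + 1) e) := by
      intro e he
      rw [r'.edge k e he, r.edge k e he, hF, ie e he, Multiset.map_map]
      congr 1
      exact Multiset.map_congr rfl fun v hv => iv v (H.edge_subset e he hv)
    refine ⟨fun v hv => ?_, he⟩
    rw [r'.vert k v hv, r.vert k v hv, hG, iv v hv, Multiset.map_map]
    congr 1
    exact Multiset.map_congr rfl fun e h => he e (Finset.mem_filter.1 h).1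

theorem map_eq_of_factor {A B L : Type} (s : Multiset A) (t : Multiset B)
    (f f' : A → L) (g g' : B → L) (F : L → L)
    (hf : ∀ a ∈ s, f' a = F (f a)) (hg : ∀ b ∈ t, g' b = F (g b))
    (h : s.map f = t.map g) : s.map f' = t.map g' := by
  have h1 : s.map f' = (s.map f).map F := by
    rw [Multiset.map_map]; exact Multiset.map_congr rfl hf
  have h2 : t.map g' = (t.map g).map F := by
    rw [Multiset.map_map]; exact Multiset.map_congr rfl hg
  rw [h1, h2, h]

theorem run_back {V₁ V₂ L : Type} [DecidableEq V₁] [DecidableEq V₂]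
    (H₁ : FinHypergraph V₁) (H₂ : FinHypergraph V₂) (ge gv : L → Multiset L → L)
    (hge : Function.Injective (fun p : L × Multiset L => ge p.1 p.2))
    (hgv : Function.Injective (fun p : L × Multiset L => gv p.1 p.2))
    (lv₁ : ℕ → V₁ → L) (le₁ : ℕ → Finset V₁ → L)
    (lv₂ : ℕ → V₂ → L) (le₂ : ℕ → Finset V₂ → L)
    (r₁ : IsRun H₁ ge gv lv₁ le₁) (r₂ : IsRun H₂ ge gv lv₂ le₂) (k K : ℕ) (hk : k ≤ K)
    (h : H₁.verts.val.map (lv₁ K) = H₂.verts.val.map (lv₂ K) ∧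
      H₁.edges.val.map (le₁ K) = H₂.edges.val.map (le₂ K)) :
    H₁.verts.val.map (lv₁ k) = H₂.verts.val.map (lv₂ k) ∧
      H₁.edges.val.map (le₁ k) = H₂.edges.val.map (le₂ k) := by
  induction K, hk using Nat.le_induction with
  | base => exact h
  | succ n _ ih =>
    obtain ⟨F, hF⟩ := exists_decode ge hge (fun a _ => a)
    obtain ⟨G, hG⟩ := exists_decode gv hgv (fun a _ => a)
    refine ih ⟨map_eq_of_factor _ _ _ _ _ _ G (fun v hv => ?_) (fun v hv => ?_) h.1,
      map_eq_of_factor _ _ _ _ _ _ F (fun e he => ?_) (fun e he => ?_) h.2⟩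
    · rw [r₁.vert n v hv, hG]
    · rw [r₂.vert n v hv, hG]
    · rw [r₁.edge n e he, hF]
    · rw [r₂.edge n e he, hF]

/-- **An HGNN with injective components is exactly as powerful as the HWL test.**
For an HGNN whose updates use injective multiset functions `fv, fe` and injective pair
functions `φe, φv`, whose initial features equal the initial HWL labels, and whose
hypergraph-level readout `R` on the pair (multiset of node features, multiset of hyperedge
features) is injective: for every `K`, the HGNN run for `K` iterations distinguishes `H₁`
from `H₂` if and only if the HWL test (with an injective hash function `g` from the same
initial labels) decides `H₁` and `H₂` non-isomorphic at some iteration `k ≤ K`. -/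
theorem hgnn_as_powerful_as_hwl
    {V₁ V₂ L Mv Me Y : Type} [DecidableEq V₁] [DecidableEq V₂] [Countable L]
    (H₁ : FinHypergraph V₁) (H₂ : FinHypergraph V₂)
    (g : L → Multiset L → L)
    (hg : Function.Injective (fun p : L × Multiset L => g p.1 p.2))
    -- HWL labels of H₁ and H₂, computed with the injective hash function g
    (lv₁ : ℕ → V₁ → L) (le₁ : ℕ → Finset V₁ → L)
    (lv₂ : ℕ → V₂ → L) (le₂ : ℕ → Finset V₂ → L)
    (hle₁ : ∀ k, ∀ e ∈ H₁.edges, le₁ (k + 1) e = g (le₁ k e) (e.val.map (lv₁ k)))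
    (hlv₁ : ∀ k, ∀ v ∈ H₁.verts,
      lv₁ (k + 1) v = g (lv₁ k v) ((H₁.incEdges v).val.map (le₁ (k + 1))))
    (hle₂ : ∀ k, ∀ e ∈ H₂.edges, le₂ (k + 1) e = g (le₂ k e) (e.val.map (lv₂ k)))
    (hlv₂ : ∀ k, ∀ v ∈ H₂.verts,
      lv₂ (k + 1) v = g (lv₂ k v) ((H₂.incEdges v).val.map (le₂ (k + 1))))
    -- the HGNN: injective multiset functions fv, fe and injective pair functions φe, φv;
    -- features live in L since initial features equal initial labels
    (fv : Multiset L → Mv) (fe : Multiset L → Me)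
    (φe : L → Mv → L) (φv : L → Me → L)
    (hfv : Function.Injective fv) (hfe : Function.Injective fe)
    (hφe : Function.Injective (fun p : L × Mv => φe p.1 p.2))
    (hφv : Function.Injective (fun p : L × Me => φv p.1 p.2))
    (hv₁ : ℕ → V₁ → L) (he₁ : ℕ → Finset V₁ → L)
    (hv₂ : ℕ → V₂ → L) (he₂ : ℕ → Finset V₂ → L)
    (hhe₁ : ∀ k, ∀ e ∈ H₁.edges,
      he₁ (k + 1) e = φe (he₁ k e) (fv (e.val.map (hv₁ k))))
    (hhv₁ : ∀ k, ∀ v ∈ H₁.verts,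
      hv₁ (k + 1) v = φv (hv₁ k v) (fe ((H₁.incEdges v).val.map (he₁ (k + 1)))))
    (hhe₂ : ∀ k, ∀ e ∈ H₂.edges,
      he₂ (k + 1) e = φe (he₂ k e) (fv (e.val.map (hv₂ k))))
    (hhv₂ : ∀ k, ∀ v ∈ H₂.verts,
      hv₂ (k + 1) v = φv (hv₂ k v) (fe ((H₂.incEdges v).val.map (he₂ (k + 1)))))
    -- initial features equal the initial HWL labels
    (h0v₁ : ∀ v ∈ H₁.verts, hv₁ 0 v = lv₁ 0 v)
    (h0e₁ : ∀ e ∈ H₁.edges, he₁ 0 e = le₁ 0 e)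
    (h0v₂ : ∀ v ∈ H₂.verts, hv₂ 0 v = lv₂ 0 v)
    (h0e₂ : ∀ e ∈ H₂.edges, he₂ 0 e = le₂ 0 e)
    -- injective hypergraph-level readout on (multiset of node features, multiset of hyperedge features)
    (R : Multiset L → Multiset L → Y)
    (hR : Function.Injective (fun p : Multiset L × Multiset L => R p.1 p.2))
    (K : ℕ) :
    (R (H₁.verts.val.map (hv₁ K)) (H₁.edges.val.map (he₁ K)) ≠
      R (H₂.verts.val.map (hv₂ K)) (H₂.edges.val.map (he₂ K))) ↔
    (∃ k ≤ K,
      H₁.verts.val.map (lv₁ k) ≠ H₂.verts.val.map (lv₂ k) ∨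
      H₁.edges.val.map (le₁ k) ≠ H₂.edges.val.map (le₂ k)) := by
  have hE : Function.Injective (fun p : L × Multiset L => φe p.1 (fv p.2)) := by
    rintro ⟨a, m⟩ ⟨b, n⟩ h
    have := @hφe (a, fv m) (b, fv n) h
    simp only [Prod.mk.injEq] at this
    rw [this.1, hfv this.2]
  have hV : Function.Injective (fun p : L × Multiset L => φv p.1 (fe p.2)) := by
    rintro ⟨a, m⟩ ⟨b, n⟩ h
    have := @hφv (a, fe m) (b, fe n) h
    simp only [Prod.mk.injEq] at this
    rw [this.1, hfe this.2]
  have r₁ : IsRun H₁ g g lv₁ le₁ := ⟨hle₁, hlv₁⟩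
  have r₂ : IsRun H₂ g g lv₂ le₂ := ⟨hle₂, hlv₂⟩
  have q₁ : IsRun H₁ (fun a m => φe a (fv m)) (fun a m => φv a (fe m)) hv₁ he₁ := ⟨hhe₁, hhv₁⟩
  have q₂ : IsRun H₂ (fun a m => φe a (fv m)) (fun a m => φv a (fe m)) hv₂ he₂ := ⟨hhe₂, hhv₂⟩
  rw [← not_iff_not]
  push Not
  constructor
  · intro h k hk
    have h' := @hR (_, _) (_, _) h
    simp only [Prod.mk.injEq] at h'
    have h'' := run_back H₁ H₂ _ _ hE hV _ _ _ _ q₁ q₂ k K hk h'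
    obtain ⟨F, G, t⟩ := run_trans (fun a m => φe a (fv m)) (fun a m => φv a (fe m)) g g hE hV k
    have t₁ := t V₁ H₁ _ _ _ _ q₁ r₁ (fun v hv => (h0v₁ v hv).symm) (fun e he => (h0e₁ e he).symm)
    have t₂ := t V₂ H₂ _ _ _ _ q₂ r₂ (fun v hv => (h0v₂ v hv).symm) (fun e he => (h0e₂ e he).symm)
    exact ⟨map_eq_of_factor _ _ _ _ _ _ G t₁.1 t₂.1 h''.1,
      map_eq_of_factor _ _ _ _ _ _ F t₁.2 t₂.2 h''.2⟩
  · intro h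
    have h' := h K le_rfl
    obtain ⟨F, G, t⟩ := run_trans g g (fun a m => φe a (fv m)) (fun a m => φv a (fe m)) hg hg K
    have t₁ := t V₁ H₁ _ _ _ _ r₁ q₁ h0v₁ h0e₁
    have t₂ := t V₂ H₂ _ _ _ _ r₂ q₂ h0v₂ h0e₂
    rw [map_eq_of_factor _ _ _ _ _ _ G t₁.1 t₂.1 h'.1,
      map_eq_of_factor _ _ _ _ _ _ F t₁.2 t₂.2 h'.2]
end

section
/- Let 𝒳 be a countable set and N a natural number. Then there exists a function f : 𝒳 → ℝ such that the map sending each multiset S over 𝒳 of size at most N to the sum ∑_{x ∈ S} f(x) (counted with multiplicity) is injective: for any two multisets S, T over 𝒳 with |S| ≤ N and |T| ≤ N, if ∑_{x ∈ S} f(x) = ∑_{x ∈ T} f(x) then S = T. -/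
open Polynomial in
theorem aux_coeff_sum (M : Multiset ℕ) (n : ℕ) :
    ((M.map (fun k => (X : ℤ[X]) ^ k)).sum).coeff n = (M.count n : ℤ) := by
  induction M using Multiset.induction_on with
  | empty => simp
  | cons a s ih =>
    rw [Multiset.map_cons, Multiset.sum_cons, coeff_add, ih, coeff_X_pow, Multiset.count_cons]
    push_cast
    ring

/-- **Deep Sets injectivity lemma (sum form).**
For a countable set `𝒳` and a bound `N`, there is a function `f : 𝒳 → ℝ` such that
the map sending a multiset `S` over `𝒳` of size at most `N` to `∑_{x ∈ S} f x`
(counted with multiplicity) is injective on such multisets. -/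
theorem exists_injective_multiset_sum (𝒳 : Type) [Countable 𝒳] (N : ℕ) :
    ∃ f : 𝒳 → ℝ, ∀ S T : Multiset 𝒳,
      Multiset.card S ≤ N → Multiset.card T ≤ N →
      (S.map f).sum = (T.map f).sum → S = T := by
  obtain ⟨g, hg⟩ := exists_injective_nat 𝒳
  have ht : Transcendental ℤ (liouvilleNumber ((2 : ℕ) : ℝ)) :=
    transcendental_liouvilleNumber le_rfl
  set t := liouvilleNumber ((2 : ℕ) : ℝ)
  rw [transcendental_iff_injective] at ht
  refine ⟨fun x => t ^ g x, fun S T _ _ h => ?_⟩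
  have key : ∀ U : Multiset 𝒳, Polynomial.aeval t
      (((U.map g).map (fun k => (Polynomial.X : Polynomial ℤ) ^ k)).sum)
      = (U.map (fun x => t ^ g x)).sum := by
    intro U
    rw [map_multiset_sum]
    simp [Multiset.map_map, Function.comp_def]
  rw [← key, ← key] at h
  have h2 := ht h
  apply Multiset.map_injective hg
  ext n
  have h3 := congrArg (fun p => Polynomial.coeff p n) h2
  simp only [aux_coeff_sum] at h3
  exact_mod_cast h3
end

section
/- Let 𝒳 be a countable set, N a natural number, and let g be any function defined on the multisets over 𝒳 of size at most N, taking values in an arbitrary set Y. Then there exist a function φ : 𝒳 → ℝ and a function ρ : ℝ → Y such that g(S) = ρ(∑_{x ∈ S} φ(x)) for every multiset S over 𝒳 with |S| ≤ N. -/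
/-- **Deep Sets decomposition lemma.**
For a countable set `𝒳`, a bound `N`, and any function `g` on multisets over `𝒳`
of size at most `N` with values in an arbitrary set `Y`, there are functions
`φ : 𝒳 → ℝ` and `ρ : ℝ → Y` such that `g S = ρ (∑_{x ∈ S} φ x)` for every
multiset `S` over `𝒳` with `|S| ≤ N`. -/
theorem multiset_function_decomposition (𝒳 : Type) [Countable 𝒳] (N : ℕ)
    (Y : Type) (g : Multiset 𝒳 → Y) :
    ∃ (φ : 𝒳 → ℝ) (ρ : ℝ → Y), ∀ S : Multiset 𝒳,
      Multiset.card S ≤ N → g S = ρ ((S.map φ).sum) := by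
  obtain ⟨e, he⟩ := exists_injective_nat 𝒳
  let p : 𝒳 → ℕ := fun x => Nat.nth Nat.Prime (e x)
  have hp : ∀ x, (p x).Prime := fun x =>
    Nat.nth_mem_of_infinite Nat.infinite_setOf_prime (e x)
  have hpi : Function.Injective p :=
    (Nat.nth_injective Nat.infinite_setOf_prime).comp he
  let φ : 𝒳 → ℝ := fun x => Real.log (p x)
  have hsum : ∀ S : Multiset 𝒳, (S.map φ).sum = Real.log (((S.map p).prod : ℕ) : ℝ) ∧
      0 < (S.map p).prod := by
    intro S
    induction S using Multiset.induction_on with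
    | empty => simp
    | cons a S ih =>
      obtain ⟨h1, h2⟩ := ih
      have ha : 0 < p a := (hp a).pos
      refine ⟨?_, by simpa using Nat.mul_pos ha h2⟩
      rw [Multiset.map_cons, Multiset.sum_cons, Multiset.map_cons, Multiset.prod_cons, h1,
        Nat.cast_mul, Real.log_mul (by exact_mod_cast ha.ne') (by exact_mod_cast h2.ne')]
  have hinj : Function.Injective (fun S : Multiset 𝒳 => (S.map φ).sum) := by
    intro S T h
    simp only [(hsum S).1, (hsum T).1] at h
    have h' := Real.log_injOn_pos (Set.mem_Ioi.2 (by exact_mod_cast (hsum S).2))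
      (Set.mem_Ioi.2 (by exact_mod_cast (hsum T).2)) h
    have h'' : (S.map p).prod = (T.map p).prod := by exact_mod_cast h'
    have key : ∀ U : Multiset 𝒳,
        UniqueFactorizationMonoid.normalizedFactors (U.map p).prod = U.map p := by
      intro U
      apply UniqueFactorizationMonoid.normalizedFactors_prod_of_prime
      intro q hq
      obtain ⟨x, -, rfl⟩ := Multiset.mem_map.1 hq
      exact (hp x).prime
    have := key S
    rw [h'', key T] at this
    exact (Multiset.map_injective hpi this).symm
  refine ⟨φ, Function.extend (fun S : Multiset 𝒳 => (S.map φ).sum) g (fun _ => g 0), ?_⟩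
  intro S _
  exact (hinj.extend_apply g _ S).symm
end

section
/- Let 𝒳 be a countable set, N a natural number, and let g be a function defined on the multisets over 𝒳 of size at most N. Then g is injective on these multisets if and only if there exist a function φ : 𝒳 → ℝ whose induced multiset-sum map S ↦ ∑_{x ∈ S} φ(x) is injective on multisets of size at most N, and an injective function ρ on the range of this sum map, such that g(S) = ρ(∑_{x ∈ S} φ(x)) for every multiset S over 𝒳 with |S| ≤ N. -/
theorem exists_phi_aux (X : Type) [Countable X] :
    ∃ φ : X → ℝ, Function.Injective (fun S : Multiset X => (S.map φ).sum) := by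
  obtain ⟨e, he⟩ := exists_injective_nat X
  let p : X → ℕ := fun x => Nat.nth Nat.Prime (e x)
  have hp : ∀ x, (p x).Prime := fun x => Nat.prime_nth_prime (e x)
  have hpi : Function.Injective p :=
    (Nat.nth_injective Nat.infinite_setOf_prime).comp he
  have hpos : ∀ S : Multiset X, (S.map p).prod ≠ 0 := by
    intro S
    rw [Ne, Multiset.prod_eq_zero_iff, Multiset.mem_map]
    rintro ⟨x, _, hx⟩
    exact (hp x).ne_zero hx
  have hlog : ∀ S : Multiset X,
      (S.map (fun x => Real.log (p x))).sum = Real.log ((S.map p).prod : ℕ) := by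
    intro S
    induction S using Multiset.induction_on with
    | empty => simp
    | cons a S ih =>
      rw [Multiset.map_cons, Multiset.sum_cons, ih, Multiset.map_cons, Multiset.prod_cons,
        Nat.cast_mul, Real.log_mul]
      · exact_mod_cast (hp a).ne_zero
      · exact_mod_cast hpos S
  refine ⟨fun x => Real.log (p x), ?_⟩
  intro S T h
  simp only [hlog] at h
  have h1 : (S.map p).prod = (T.map p).prod := by
    have := Real.log_injOn_pos
      (Set.mem_Ioi.2 (Nat.cast_pos.2 (Nat.pos_of_ne_zero (hpos S))))
      (Set.mem_Ioi.2 (Nat.cast_pos.2 (Nat.pos_of_ne_zero (hpos T)))) h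
    exact_mod_cast this
  have key : ∀ S : Multiset X,
      UniqueFactorizationMonoid.normalizedFactors (S.map p).prod = S.map p := by
    intro S
    apply UniqueFactorizationMonoid.normalizedFactors_prod_of_prime
    intro q hq
    obtain ⟨x, _, rfl⟩ := Multiset.mem_map.1 hq
    exact (hp x).prime
  apply Multiset.map_injective hpi
  rw [← key S, h1, key T]

/-- **Deep Sets characterization of injective multiset functions (Lemma 1 of the paper).**
For a countable set `𝒳`, a bound `N`, and a function `g` on multisets over `𝒳` of size at
most `N`, `g` is injective on these multisets if and only if it decomposes as
`g S = ρ (∑_{x ∈ S} φ x)` where the multiset-sum map `S ↦ ∑_{x ∈ S} φ x` is injective on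
multisets of size at most `N` and `ρ` is injective on the range of this sum map. -/
theorem multiset_injective_iff_sum_decomposition (𝒳 : Type) [Countable 𝒳] (N : ℕ)
    (Y : Type) (g : Multiset 𝒳 → Y) :
    (∀ S T : Multiset 𝒳, Multiset.card S ≤ N → Multiset.card T ≤ N →
        g S = g T → S = T) ↔
    ∃ (φ : 𝒳 → ℝ) (ρ : ℝ → Y),
      (∀ S T : Multiset 𝒳, Multiset.card S ≤ N → Multiset.card T ≤ N →
        (S.map φ).sum = (T.map φ).sum → S = T) ∧
      Set.InjOn ρ {r : ℝ | ∃ S : Multiset 𝒳, Multiset.card S ≤ N ∧ (S.map φ).sum = r} ∧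
      (∀ S : Multiset 𝒳, Multiset.card S ≤ N → g S = ρ ((S.map φ).sum)) := by
  constructor
  · intro hg
    obtain ⟨φ, hφ⟩ := exists_phi_aux 𝒳
    have hext : ∀ S : Multiset 𝒳,
        Function.extend (fun S : Multiset 𝒳 => (S.map φ).sum) g (fun _ => g 0) (S.map φ).sum
          = g S := fun S => hφ.extend_apply g (fun _ => g 0) S
    refine ⟨φ, Function.extend (fun S : Multiset 𝒳 => (S.map φ).sum) g (fun _ => g 0),
      fun S T _ _ h => hφ h, ?_, fun S _ => (hext S).symm⟩
    rintro _ ⟨S, hS, rfl⟩ _ ⟨T, hT, rfl⟩ h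
    rw [hext, hext] at h
    rw [hg S T hS hT h]
  · rintro ⟨φ, ρ, h1, h2, h3⟩ S T hS hT h
    rw [h3 S hS, h3 T hT] at h
    exact h1 S T hS hT (h2 ⟨S, hS, rfl⟩ ⟨T, hT, rfl⟩ h)
end

section
/- Let 𝒳 be a countable set and N a natural number. Then there exists a function f : 𝒳 → ℝ such that for every irrational number ε, the map h defined by h(c, S) = (1 + ε)·f(c) + ∑_{x ∈ S} f(x) is injective on pairs (c, S) where c ∈ 𝒳 and S is a multiset over 𝒳 of size at most N: if h(c, S) = h(c', S') for two such pairs, then c = c' and S = S'. -/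
theorem aux_le (N : ℕ) (S S' : Multiset ℕ) (hS : Multiset.card S ≤ N)
    (h : (S.map (fun i => (N+2)^i)).sum = (S'.map (fun i => (N+2)^i)).sum)
    (x x' : ℕ) (hx : ∀ y ∈ S, y ≤ x) (hx' : x' ∈ S') : x' ≤ x := by
  by_contra hlt
  push Not at hlt
  have h1 : (S.map (fun i => (N+2)^i)).sum ≤ Multiset.card S * (N+2)^x := by
    have := Multiset.sum_le_card_nsmul (S.map (fun i => (N+2)^i)) ((N+2)^x) (by
      intro z hz
      obtain ⟨y, hy, rfl⟩ := Multiset.mem_map.1 hz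
      exact Nat.pow_le_pow_right (by omega) (hx y hy))
    simpa using this
  have h2 : (N+2)^x' ≤ (S'.map (fun i => (N+2)^i)).sum :=
    Multiset.le_sum_of_mem (Multiset.mem_map_of_mem (fun i => (N+2)^i) hx')
  have h3 : (N+2)^(x+1) ≤ (N+2)^x' := Nat.pow_le_pow_right (by omega) hlt
  have h4 : Multiset.card S * (N+2)^x ≤ N * (N+2)^x := Nat.mul_le_mul_right _ hS
  have h5 : 0 < (N+2)^x := by positivity
  rw [pow_succ] at h3
  nlinarith

theorem aux_max (S : Multiset ℕ) (hS : S ≠ 0) : ∃ x ∈ S, ∀ y ∈ S, y ≤ x := by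
  obtain ⟨x, hx, h⟩ := Finset.exists_max_image S.toFinset id (by simpa using hS)
  exact ⟨x, by simpa using hx, fun y hy => h y (by simpa using hy)⟩

theorem aux_inj (N n : ℕ) : ∀ (S S' : Multiset ℕ), Multiset.card S = n →
    Multiset.card S ≤ N → Multiset.card S' ≤ N →
    (S.map (fun i => (N+2)^i)).sum = (S'.map (fun i => (N+2)^i)).sum → S = S' := by
  induction n with
  | zero =>
    intro S S' h0 _ _ h
    rw [Multiset.card_eq_zero] at h0
    subst h0
    by_contra hne
    obtain ⟨x, hx⟩ := Multiset.exists_mem_of_ne_zero (Ne.symm hne)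
    have h2 : (N+2)^x ≤ (S'.map (fun i => (N+2)^i)).sum :=
      Multiset.le_sum_of_mem (Multiset.mem_map_of_mem (fun i => (N+2)^i) hx)
    have h5 : 0 < (N+2)^x := by positivity
    simp only [Multiset.map_zero, Multiset.sum_zero] at h
    omega
  | succ n ih =>
    intro S S' hn hS hS' h
    have hS0 : S ≠ 0 := by rintro rfl; simp at hn
    obtain ⟨x, hx, hxm⟩ := aux_max S hS0
    have hS0' : S' ≠ 0 := by
      rintro rfl
      have h2 : (N+2)^x ≤ (S.map (fun i => (N+2)^i)).sum :=
        Multiset.le_sum_of_mem (Multiset.mem_map_of_mem (fun i => (N+2)^i) hx)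
      have h5 : 0 < (N+2)^x := by positivity
      simp only [Multiset.map_zero, Multiset.sum_zero] at h
      omega
    obtain ⟨x', hx', hxm'⟩ := aux_max S' hS0'
    have e : x' = x := le_antisymm (aux_le N S S' hS h x x' hxm hx')
      (aux_le N S' S hS' h.symm x' x hxm' hx)
    subst e
    obtain ⟨T, rfl⟩ := Multiset.exists_cons_of_mem hx
    obtain ⟨T', rfl⟩ := Multiset.exists_cons_of_mem hx'
    simp only [Multiset.map_cons, Multiset.sum_cons, Multiset.card_cons] at *
    rw [ih T T' (by omega) (by omega) (by omega) (by omega)]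

/-- **GIN pair-injectivity lemma (existence part).**
For a countable set `𝒳` and a bound `N`, there is a function `f : 𝒳 → ℝ` such that for
every irrational `ε`, the map `h (c, S) = (1 + ε) · f c + ∑_{x ∈ S} f x` is injective on
pairs `(c, S)` with `c ∈ 𝒳` and `S` a multiset over `𝒳` of size at most `N`. -/
theorem exists_injective_eps_sum (𝒳 : Type) [Countable 𝒳] (N : ℕ) :
    ∃ f : 𝒳 → ℝ, ∀ ε : ℝ, Irrational ε →
      ∀ (c c' : 𝒳) (S S' : Multiset 𝒳),
        Multiset.card S ≤ N → Multiset.card S' ≤ N →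
        (1 + ε) * f c + (S.map f).sum = (1 + ε) * f c' + (S'.map f).sum →
        c = c' ∧ S = S' := by
  obtain ⟨g, hg⟩ := Countable.exists_injective_nat 𝒳
  refine ⟨fun x => (((N+2)^(g x) : ℕ) : ℝ), ?_⟩
  intro ε hε c c' S S' hS hS' h
  have key : ∀ T : Multiset 𝒳, (T.map (fun x => (((N+2)^(g x) : ℕ) : ℝ))).sum
      = ((((T.map g).map (fun i => (N+2)^i)).sum : ℕ) : ℝ) := by
    intro T
    rw [Nat.cast_multiset_sum, Multiset.map_map, Multiset.map_map]
    rfl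
  rw [key, key] at h
  have hc : c = c' := by
    by_contra hne
    have hne' : (N+2)^(g c) ≠ (N+2)^(g c') := fun e =>
      hne (hg (Nat.pow_right_injective (by omega : 2 ≤ N+2) e))
    simp only at h
    generalize (N+2)^(g c) = a at *
    generalize (N+2)^(g c') = b at *
    generalize ((S.map g).map (fun i => (N+2)^i)).sum = s at *
    generalize ((S'.map g).map (fun i => (N+2)^i)).sum = t at *
    have hab : (a : ℝ) - b ≠ 0 := by
      rw [sub_ne_zero]; exact_mod_cast hne'
    apply hε
    refine ⟨((t : ℚ) - s) / (a - b) - 1, ?_⟩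
    push_cast
    field_simp
    linarith
  subst hc
  refine ⟨rfl, Multiset.map_injective hg (aux_inj N _ _ _ rfl (by simpa) (by simpa) ?_)⟩
  exact_mod_cast add_left_cancel h
end
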